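/- For every f∈C_c^∞(ℝ), as τ↓0: σ_τ(f)² = (τ/(2π))∫_ℝ (f'(x))² dx + O(τ²). -/

import Mathlib

open MeasureTheory Filter Topology Asymptotics

noncomputable section

namespace DysonMeso

/-- `σ_τ(f)² = (τ/(2π²)) ∬ ((f(u)-f(v))/(u-v))² · 2τ/((u-v)²+4τ²) du dv`. -/
def sigmaTauSq (τ : ℝ) (f : ℝ → ℝ) : ℝ :=
  (τ / (2 * Real.pi ^ 2)) * ∫ p : ℝ × ℝ,
    ((f p.1 - f p.2) / (p.1 - p.2)) ^ 2 * (2 * τ / ((p.1 - p.2) ^ 2 + 4 * τ ^ 2))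

/-- The Cauchy kernel of width `2τ`, of total mass `π`. -/
def cauchyKernel (τ s : ℝ) : ℝ := 2 * τ / (s ^ 2 + 4 * τ ^ 2)

/-- The squared `L²` norm of the difference quotient of `f` with step `s`. -/
def diffQuotEnergy (f : ℝ → ℝ) (s : ℝ) : ℝ := ∫ v, ((f (v + s) - f v) / s) ^ 2

lemma cauchyKernel_eq {τ : ℝ} (hτ : 0 < τ) (s : ℝ) :
    cauchyKernel τ s = (2 * τ)⁻¹ * (1 + (s / (2 * τ)) ^ 2)⁻¹ := by
  unfold cauchyKernel
  have h : 0 < s ^ 2 + 4 * τ ^ 2 := by positivity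
  have h' : 0 < 1 + (s / (2 * τ)) ^ 2 := by positivity
  field_simp
  ring

lemma integrable_cauchyKernel {τ : ℝ} (hτ : 0 < τ) : Integrable (cauchyKernel τ) := by
  rw [funext (cauchyKernel_eq hτ)]
  exact (integrable_inv_one_add_sq.comp_div (R := 2 * τ) (by positivity)).const_mul _

lemma integral_cauchyKernel {τ : ℝ} (hτ : 0 < τ) : ∫ s, cauchyKernel τ s = Real.pi := by
  simp_rw [cauchyKernel_eq hτ]
  rw [integral_const_mul, Measure.integral_comp_div (fun x : ℝ => (1 + x ^ 2)⁻¹),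
    integral_univ_inv_one_add_sq, abs_of_pos (by positivity), smul_eq_mul]
  field_simp

lemma cauchyKernel_nonneg {τ : ℝ} (hτ : 0 < τ) (s : ℝ) : 0 ≤ cauchyKernel τ s := by
  unfold cauchyKernel
  positivity

lemma measurable_cauchyKernel (τ : ℝ) : Measurable (cauchyKernel τ) := by
  unfold cauchyKernel
  fun_prop

lemma sq_mul_cauchyKernel_le {τ : ℝ} (hτ : 0 < τ) (s : ℝ) : s ^ 2 * cauchyKernel τ s ≤ 2 * τ := by
  unfold cauchyKernel
  have h : 0 < s ^ 2 + 4 * τ ^ 2 := by positivity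
  rw [mul_div_assoc', div_le_iff₀ h]
  nlinarith [pow_pos hτ 3]

lemma abs_symmDiff_sub_le {f : ℝ → ℝ} (hf : ContDiff ℝ 2 f) {M : NNReal}
    (hM : LipschitzWith M (deriv (deriv f))) (x h : ℝ) :
    |f (x + h) - f (x - h) - 2 * h * deriv f x| ≤ 2 * M * |h| ^ 3 := by
  have hf1 : ContDiff ℝ 1 (deriv f) := hf.deriv'
  have d0 (y : ℝ) : HasDerivAt f (deriv f y) y :=
    (hf.differentiable (by norm_num) y).hasDerivAt
  have d1 (y : ℝ) : HasDerivAt (deriv f) (deriv (deriv f) y) y :=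
    (hf1.differentiable (by norm_num) y).hasDerivAt
  have hconv : Convex ℝ (Metric.closedBall (0 : ℝ) |h|) := convex_closedBall _ _
  have h0 : (0 : ℝ) ∈ Metric.closedBall (0 : ℝ) |h| := Metric.mem_closedBall_self (abs_nonneg _)
  have hh : h ∈ Metric.closedBall (0 : ℝ) |h| := by simp
  have hmem {t : ℝ} (ht : t ∈ Metric.closedBall (0 : ℝ) |h|) : |t| ≤ |h| := by simpa using ht
  have e1 (t : ℝ) : HasDerivAt (fun t => deriv f (x + t) + deriv f (x - t) - 2 * deriv f x)
      (deriv (deriv f) (x + t) - deriv (deriv f) (x - t)) t := by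
    exact ((((d1 (x + t)).comp_const_add x t).add ((d1 (x - t)).comp_const_sub x t)).sub_const
      (2 * deriv f x)).congr_deriv (by ring)
  have e0 (t : ℝ) : HasDerivAt (fun t => f (x + t) - f (x - t) - 2 * t * deriv f x)
      (deriv f (x + t) + deriv f (x - t) - 2 * deriv f x) t := by
    exact ((((d0 (x + t)).comp_const_add x t).sub ((d0 (x - t)).comp_const_sub x t)).sub
      (((hasDerivAt_id t).const_mul 2).mul_const (deriv f x))).congr_deriv (by ring)
  have b2 (t : ℝ) (ht : t ∈ Metric.closedBall (0 : ℝ) |h|) :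
      ‖deriv (deriv f) (x + t) - deriv (deriv f) (x - t)‖ ≤ 2 * M * |h| := by
    have := hM.dist_le_mul (x + t) (x - t)
    rw [dist_eq_norm, Real.dist_eq, show x + t - (x - t) = 2 * t by ring, abs_mul, abs_two] at this
    nlinarith [hmem ht, M.coe_nonneg]
  have b1 (t : ℝ) (ht : t ∈ Metric.closedBall (0 : ℝ) |h|) :
      ‖deriv f (x + t) + deriv f (x - t) - 2 * deriv f x‖ ≤ 2 * M * |h| ^ 2 := by
    have := hconv.norm_image_sub_le_of_norm_hasDerivWithin_le
      (fun t _ => (e1 t).hasDerivWithinAt) b2 h0 ht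
    simp only [add_zero, sub_zero, Real.norm_eq_abs t] at this
    rw [show deriv f x + deriv f x - 2 * deriv f x = 0 by ring, sub_zero] at this
    have := mul_le_mul_of_nonneg_left (hmem ht) (show 0 ≤ 2 * M * |h| by positivity)
    linarith
  have := hconv.norm_image_sub_le_of_norm_hasDerivWithin_le
    (fun t _ => (e0 t).hasDerivWithinAt) b1 h0 hh
  simp only [add_zero, sub_zero, mul_zero, zero_mul, sub_self, Real.norm_eq_abs] at this
  linarith

lemma diffQuotEnergy_eq_symm (f : ℝ → ℝ) (s : ℝ) :
    diffQuotEnergy f s = ∫ x, ((f (x + s / 2) - f (x - s / 2)) / s) ^ 2 := by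
  unfold diffQuotEnergy
  rw [← integral_sub_right_eq_self (fun v => ((f (v + s) - f v) / s) ^ 2) (s / 2)]
  congr! 6
  ring

lemma integrable_sq_of_hasCompactSupport {g : ℝ → ℝ} (hg : Continuous g)
    (hc : HasCompactSupport g) : Integrable fun x => g x ^ 2 :=
  have hg2 : Continuous fun x => g x ^ 2 := by fun_prop
  have hc2 : HasCompactSupport fun x => g x ^ 2 :=
    hc.comp_left (g := fun y : ℝ => y ^ 2) (by norm_num)
  hg2.integrable_of_hasCompactSupport hc2

lemma integrable_symmDiffQuot_sq {f : ℝ → ℝ} (hf : Continuous f) (hc : HasCompactSupport f)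
    (s : ℝ) : Integrable fun x => ((f (x + s / 2) - f (x - s / 2)) / s) ^ 2 := by
  have h := (hc.comp_homeomorph (Homeomorph.addRight (s / 2))).sub
    (hc.comp_homeomorph (Homeomorph.subRight (s / 2)))
  exact integrable_sq_of_hasCompactSupport (by fun_prop)
    (h.comp_left (g := fun y : ℝ => y / s) (by simp))

lemma abs_diffQuotEnergy_sub_le_of_abs_le_one {f : ℝ → ℝ} (hf : ContDiff ℝ 3 f)
    (hc : HasCompactSupport f) :
    ∃ C : ℝ, 0 ≤ C ∧ ∀ s : ℝ, s ≠ 0 → |s| ≤ 1 →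
      |diffQuotEnergy f s - ∫ x, deriv f x ^ 2| ≤ C * s ^ 2 := by
  obtain ⟨L, hL⟩ := hf.lipschitzWith_of_hasCompactSupport hc (by norm_num)
  have hf1 : ContDiff ℝ 2 (deriv f) := hf.deriv'
  have hf2 : ContDiff ℝ 1 (deriv (deriv f)) := hf1.deriv'
  obtain ⟨M, hM⟩ := hf2.lipschitzWith_of_hasCompactSupport hc.deriv.deriv (by norm_num)
  obtain ⟨R, hR⟩ := hc.isCompact.isBounded.subset_closedBall (0 : ℝ)
  have hzero {x : ℝ} (hx : R < |x|) : f x = 0 := by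
    by_contra h
    have := hR (subset_tsupport f h)
    simp only [Metric.mem_closedBall, dist_zero_right, Real.norm_eq_abs] at this
    linarith
  have hzero' {x : ℝ} (hx : R < |x|) : deriv f x = 0 := by
    by_contra h
    have := hR (tsupport_deriv_subset (subset_tsupport (deriv f) h))
    simp only [Metric.mem_closedBall, dist_zero_right, Real.norm_eq_abs] at this
    linarith
  set B := Metric.closedBall (0 : ℝ) (R + 1)
  refine ⟨M / 4 * (2 * L) * volume.real B, by positivity, fun s hs hs1 => ?_⟩
  have hspos : 0 < |s| := abs_pos.mpr hs
  have hpt (x : ℝ) : |((f (x + s / 2) - f (x - s / 2)) / s) ^ 2 - deriv f x ^ 2| ≤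
      B.indicator (fun _ => M / 4 * (2 * L) * s ^ 2) x := by
    by_cases hx : x ∈ B
    · rw [Set.indicator_of_mem hx]
      have hd : |(f (x + s / 2) - f (x - s / 2)) / s| ≤ L := by
        have := hL.dist_le_mul (x + s / 2) (x - s / 2)
        rw [Real.dist_eq, Real.dist_eq, show x + s / 2 - (x - s / 2) = s by ring] at this
        rwa [abs_div, div_le_iff₀ hspos]
      have hd' : |deriv f x| ≤ L := norm_deriv_le_of_lipschitz hL
      have hdiff : |(f (x + s / 2) - f (x - s / 2)) / s - deriv f x| ≤ M / 4 * s ^ 2 := by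
        have := abs_symmDiff_sub_le (hf.of_le (by norm_num)) hM x (s / 2)
        rw [show (f (x + s / 2) - f (x - s / 2)) / s - deriv f x =
          (f (x + s / 2) - f (x - s / 2) - 2 * (s / 2) * deriv f x) / s by field_simp,
          abs_div, div_le_iff₀ hspos]
        refine this.trans (le_of_eq ?_)
        rw [abs_div, abs_two, ← sq_abs s]
        ring
      rw [sq_sub_sq, abs_mul, mul_comm]
      have hsum := (abs_add_le ((f (x + s / 2) - f (x - s / 2)) / s) (deriv f x)).trans
        (add_le_add hd hd')
      calc _ ≤ M / 4 * s ^ 2 * (L + L) := by gcongr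
        _ = _ := by ring
    · rw [Set.indicator_of_notMem hx]
      have hx' : R + 1 < |x| := by simpa [B] using hx
      have hs2 : |s / 2| ≤ 1 / 2 := by rw [abs_div, abs_two]; linarith
      have h1 : |x| - |s / 2| ≤ |x + s / 2| := by
        simpa using abs_sub_abs_le_abs_sub x (-(s / 2))
      have h2 := abs_sub_abs_le_abs_sub x (s / 2)
      rw [hzero (x := x + s / 2) (by linarith), hzero (x := x - s / 2) (by linarith),
        hzero' (by linarith)]
      simp
  rw [diffQuotEnergy_eq_symm, ← integral_sub
    (integrable_symmDiffQuot_sq hf.continuous hc s)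
    (integrable_sq_of_hasCompactSupport hf1.continuous hc.deriv)]
  have hB : MeasurableSet B := Metric.isClosed_closedBall.measurableSet
  have hint : Integrable (B.indicator (fun _ => M / 4 * (2 * L) * s ^ 2)) :=
    (integrable_indicator_iff hB).mpr (integrableOn_const measure_closedBall_lt_top.ne)
  have := norm_integral_le_of_norm_le hint
    (f := fun x => ((f (x + s / 2) - f (x - s / 2)) / s) ^ 2 - deriv f x ^ 2) (.of_forall hpt)
  rw [integral_indicator_const _ hB, smul_eq_mul, Real.norm_eq_abs] at this
  linarith

lemma diffQuotEnergy_nonneg (f : ℝ → ℝ) (s : ℝ) : 0 ≤ diffQuotEnergy f s :=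
  integral_nonneg fun _ => sq_nonneg _

lemma diffQuotEnergy_le_of_one_le_abs {f : ℝ → ℝ} (hf : Continuous f) (hc : HasCompactSupport f)
    {s : ℝ} (hs : 1 ≤ |s|) : diffQuotEnergy f s ≤ 4 * ∫ x, f x ^ 2 := by
  have hi := integrable_sq_of_hasCompactSupport hf hc
  have hs2 : 1 ≤ s ^ 2 := by rw [← sq_abs]; nlinarith
  have hpt (v : ℝ) : ((f (v + s) - f v) / s) ^ 2 ≤ 2 * f (v + s) ^ 2 + 2 * f v ^ 2 := by
    rw [div_pow]
    refine (div_le_self (sq_nonneg _) hs2).trans ?_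
    nlinarith [sq_nonneg (f (v + s) + f v)]
  have his : Integrable fun v => 2 * f (v + s) ^ 2 := (hi.comp_add_right s).const_mul 2
  calc diffQuotEnergy f s ≤ ∫ v, (2 * f (v + s) ^ 2 + 2 * f v ^ 2) :=
        integral_mono_of_nonneg (.of_forall fun _ => sq_nonneg _) (his.add (hi.const_mul 2))
          (.of_forall hpt)
    _ = 4 * ∫ x, f x ^ 2 := by
        rw [integral_add his (hi.const_mul 2), integral_const_mul, integral_const_mul,
          integral_add_right_eq_self (fun v => f v ^ 2)]
        ring

lemma abs_diffQuotEnergy_sub_le {f : ℝ → ℝ} (hf : ContDiff ℝ 3 f) (hc : HasCompactSupport f) :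
    ∃ C : ℝ, 0 ≤ C ∧ ∀ s : ℝ, s ≠ 0 →
      |diffQuotEnergy f s - ∫ x, deriv f x ^ 2| ≤ C * (s ^ 2 * (1 + s ^ 2)⁻¹) := by
  obtain ⟨C, hC, h⟩ := abs_diffQuotEnergy_sub_le_of_abs_le_one hf hc
  set A := ∫ x, deriv f x ^ 2
  set E := ∫ x, f x ^ 2
  have hA : 0 ≤ A := integral_nonneg fun _ => sq_nonneg _
  have hE : 0 ≤ E := integral_nonneg fun _ => sq_nonneg _
  refine ⟨2 * (C + 4 * E + A), by positivity, fun s hs => ?_⟩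
  rw [← div_eq_mul_inv, mul_div_assoc', le_div_iff₀ (by positivity)]
  rcases le_total |s| 1 with h1 | h1
  · have hs2 : s ^ 2 ≤ 1 := by rw [← sq_abs]; nlinarith [abs_nonneg s]
    calc _ ≤ C * s ^ 2 * 2 := by
          gcongr
          · exact h s hs h1
          · linarith
      _ ≤ _ := by nlinarith [mul_nonneg hE (sq_nonneg s), mul_nonneg hA (sq_nonneg s)]
  · have hs2 : 1 ≤ s ^ 2 := by rw [← sq_abs]; nlinarith
    have hle := diffQuotEnergy_le_of_one_le_abs hf.continuous hc h1
    have hnn := diffQuotEnergy_nonneg f s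
    have hb : |diffQuotEnergy f s - A| ≤ C + 4 * E + A := by
      rw [abs_le]
      constructor <;> linarith
    calc _ ≤ (C + 4 * E + A) * (2 * s ^ 2) := by
          gcongr
          linarith
      _ = _ := by ring

lemma integrable_diffQuot_sq_mul_cauchyKernel {f : ℝ → ℝ} (hf : ContDiff ℝ 1 f)
    (hc : HasCompactSupport f) {τ : ℝ} (hτ : 0 < τ) :
    Integrable fun p : ℝ × ℝ => ((f (p.2 + p.1) - f p.2) / p.1) ^ 2 * cauchyKernel τ p.1 := by
  obtain ⟨L, hL⟩ := hf.lipschitzWith_of_hasCompactSupport hc (by norm_num)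
  have hfm : Measurable f := hf.continuous.measurable
  have hKm := measurable_cauchyKernel τ
  set χ : ℝ → ℝ := (tsupport f).indicator 1
  have hχ0 (x : ℝ) : 0 ≤ χ x := Set.indicator_nonneg (fun _ _ => zero_le_one) x
  have hχ1 {x : ℝ} (hx : f x ≠ 0) : χ x = 1 := by
    simp [χ, Set.indicator_of_mem (subset_tsupport f hx)]
  have hχ : Integrable χ := (integrable_indicator_iff (isClosed_tsupport f).measurableSet).mpr
    (integrableOn_const (C := (1 : ℝ)) hc.isCompact.measure_lt_top.ne)
  have hi : Integrable fun p : ℝ × ℝ => cauchyKernel τ p.1 * χ p.2 :=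
    (integrable_cauchyKernel hτ).mul_prod hχ
  have hi' : Integrable fun p : ℝ × ℝ => cauchyKernel τ p.1 * χ (p.1 + p.2) :=
    (measurePreserving_prod_add (volume : Measure ℝ) (volume : Measure ℝ)).integrable_comp_of_integrable
      hi
  refine ((hi.add hi').const_mul ((L : ℝ) ^ 2)).mono' (by fun_prop) (.of_forall fun p => ?_)
  obtain ⟨s, v⟩ := p
  have hK := cauchyKernel_nonneg hτ s
  simp only [Pi.add_apply]
  rw [Real.norm_of_nonneg (mul_nonneg (sq_nonneg _) hK), ← mul_add, mul_left_comm, mul_comm]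
  refine mul_le_mul_of_nonneg_left ?_ hK
  have hq : ((f (v + s) - f v) / s) ^ 2 ≤ (L : ℝ) ^ 2 := by
    rw [← sq_abs]
    gcongr
    have := hL.dist_le_mul (v + s) v
    rw [Real.dist_eq, Real.dist_eq, add_sub_cancel_left] at this
    rw [abs_div]
    exact div_le_of_le_mul₀ (abs_nonneg _) L.coe_nonneg this
  have hL2 : 0 ≤ (L : ℝ) ^ 2 := by positivity
  by_cases h1 : f v = 0
  · by_cases h2 : f (v + s) = 0
    · simp only [h1, h2, sub_self, zero_div, zero_pow two_ne_zero]
      exact mul_nonneg hL2 (add_nonneg (hχ0 v) (hχ0 (s + v)))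
    · rw [add_comm s v, hχ1 h2]
      nlinarith [hχ0 v]
  · rw [hχ1 h1]
    nlinarith [hχ0 (s + v)]

lemma sigmaTauSq_eq {f : ℝ → ℝ} (hf : ContDiff ℝ 1 f) (hc : HasCompactSupport f) {τ : ℝ}
    (hτ : 0 < τ) :
    Integrable (fun s => diffQuotEnergy f s * cauchyKernel τ s) ∧
      sigmaTauSq τ f =
        (τ / (2 * Real.pi ^ 2)) * ∫ s, diffQuotEnergy f s * cauchyKernel τ s := by
  have hi := integrable_diffQuot_sq_mul_cauchyKernel hf hc hτ
  have hmp := measurePreserving_sub_prod (volume : Measure ℝ) (volume : Measure ℝ)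
  have hfib (s : ℝ) : ∫ v, ((f (v + s) - f v) / s) ^ 2 * cauchyKernel τ s =
      diffQuotEnergy f s * cauchyKernel τ s := integral_mul_const _ _
  refine ⟨by simpa only [hfib] using hi.integral_prod_left, ?_⟩
  unfold sigmaTauSq
  congr 1
  have hprod := integral_prod _ hi
  simp only [hfib] at hprod
  rw [← hprod, ← hmp.map_eq, integral_map hmp.measurable.aemeasurable (by
    rw [hmp.map_eq]; exact hi.aestronglyMeasurable), ← Measure.volume_eq_prod]
  simp [cauchyKernel]

/-- As `τ ↓ 0`, `σ_τ(f)² = (τ/(2π)) ∫ f'(x)² dx + O(τ²)` for `f ∈ C_c^∞(ℝ)`. -/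
theorem sigmaTau_small (f : ℝ → ℝ) (hf : ContDiff ℝ (⊤ : ℕ∞) f) (hsupp : HasCompactSupport f) :
    (fun τ : ℝ => sigmaTauSq τ f - (τ / (2 * Real.pi)) * ∫ x : ℝ, deriv f x ^ 2)
      =O[𝓝[>] (0 : ℝ)] fun τ : ℝ => τ ^ 2 := by
  have hf3 : ContDiff ℝ 3 f := hf.of_le (WithTop.coe_le_coe.mpr le_top)
  obtain ⟨C, hC, hbound⟩ := abs_diffQuotEnergy_sub_le hf3 hsupp
  refine IsBigO.of_bound (C / Real.pi) ?_
  filter_upwards [self_mem_nhdsWithin] with τ hτ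
  replace hτ : 0 < τ := hτ
  obtain ⟨hi, heq⟩ := sigmaTauSq_eq (hf3.of_le (by norm_num)) hsupp hτ
  set A := ∫ x, deriv f x ^ 2
  have hiA : Integrable fun s => A * cauchyKernel τ s := (integrable_cauchyKernel hτ).const_mul A
  have hrepr : sigmaTauSq τ f - τ / (2 * Real.pi) * A = (τ / (2 * Real.pi ^ 2)) *
      ∫ s, (diffQuotEnergy f s * cauchyKernel τ s - A * cauchyKernel τ s) := by
    rw [integral_sub hi hiA, integral_const_mul, integral_cauchyKernel hτ, heq]
    field_simp
  have hle : ‖∫ s, (diffQuotEnergy f s * cauchyKernel τ s - A * cauchyKernel τ s)‖ ≤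
      ∫ s : ℝ, C * (2 * τ) * (1 + s ^ 2)⁻¹ := by
    refine norm_integral_le_of_norm_le (integrable_inv_one_add_sq.const_mul _) ?_
    filter_upwards [Measure.ae_ne volume (0 : ℝ)] with s hs
    have hK := cauchyKernel_nonneg hτ s
    rw [← sub_mul, norm_mul, Real.norm_of_nonneg hK, Real.norm_eq_abs]
    calc _ ≤ C * (s ^ 2 * (1 + s ^ 2)⁻¹) * cauchyKernel τ s := by
          gcongr
          exact hbound s hs
      _ = C * (s ^ 2 * cauchyKernel τ s) * (1 + s ^ 2)⁻¹ := by ring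
      _ ≤ C * (2 * τ) * (1 + s ^ 2)⁻¹ := by
          refine mul_le_mul_of_nonneg_right (mul_le_mul_of_nonneg_left ?_ hC) (by positivity)
          exact sq_mul_cauchyKernel_le hτ s
  rw [integral_const_mul, integral_univ_inv_one_add_sq] at hle
  have hpi := Real.pi_pos
  have hcoef : 0 ≤ τ / (2 * Real.pi ^ 2) := by positivity
  rw [hrepr, norm_mul, Real.norm_of_nonneg hcoef, Real.norm_of_nonneg (sq_nonneg τ)]
  calc _ ≤ τ / (2 * Real.pi ^ 2) * (C * (2 * τ) * Real.pi) := by gcongr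
    _ = _ := by field_simp

end DysonMeso
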